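/- Let v ∈ P and let ω̃(v) ∈ Γ be the unique common solution (the unique simultaneous maximizer over Γ of g̃_v and of g̃_v^{(j)} for every j). Then for every j ∈ {1,…,L}, the eigenspace of the matrix H^{(j)}(v) associated with the eigenvalue 1/g̃_v^{(j)}(ω̃(v)) is one-dimensional. (Lemma 15 of the paper.) -/

import Mathlib

open Finset
open scoped Classical

namespace HetTS

noncomputable section

variable {K M : ℕ}

/-- Number of clients having access to arm `i`. -/
def Mi (S : Fin M → Finset (Fin K)) (i : Fin K) : ℕ :=
  (Finset.univ.filter fun m => i ∈ S m).card

/-- The mean reward `μ_i(v)` of arm `i`: average of the means of arm `i` across the clients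
having access to it. -/
def armMean (S : Fin M → Finset (Fin K)) (v : Fin M → Fin K → ℝ) (i : Fin K) : ℝ :=
  (1 / (Mi S i : ℝ)) * ∑ m ∈ Finset.univ.filter (fun m => i ∈ S m), v m i

/-- Arm `i` is the (unique) best arm of client `m` under instance `v`. -/
def isBest (S : Fin M → Finset (Fin K)) (v : Fin M → Fin K → ℝ) (m : Fin M) (i : Fin K) :
    Prop :=
  i ∈ S m ∧ ∀ j ∈ S m, j ≠ i → armMean S v j < armMean S v i

/-- The set `P` of problem instances having a unique best arm at each client. -/
def PSet (S : Fin M → Finset (Fin K)) : Set (Fin M → Fin K → ℝ) :=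
  {v | ∀ m, ∃ i, isBest S v m i}

/-- The set of alternative instances `Alt(v)`: instances in `P` whose tuple of best arms
differs from that of `v`. -/
def AltSet (S : Fin M → Finset (Fin K)) (v : Fin M → Fin K → ℝ) :
    Set (Fin M → Fin K → ℝ) :=
  {v' | v' ∈ PSet S ∧ ¬ ∀ (m : Fin M) (i : Fin K), isBest S v m i ↔ isBest S v' m i}

/-- The set `Γ` of allocations: families `(ω_{i,m})_{m, i ∈ S_m}` of nonnegative weights
summing to one for each client (represented as functions vanishing off the support). -/
def Gam (S : Fin M → Finset (Fin K)) : Set (Fin M → Fin K → ℝ) :=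
  {ω | (∀ m, ∀ i ∈ S m, 0 ≤ ω m i) ∧ (∀ m, ∑ i ∈ S m, ω m i = 1) ∧
    ∀ m, ∀ i, i ∉ S m → ω m i = 0}

/-- `g_v(ω)`, the inner infimum over alternative instances. -/
def gfun (S : Fin M → Finset (Fin K)) (v ω : Fin M → Fin K → ℝ) : ℝ :=
  sInf {x | ∃ v' ∈ AltSet S v,
    x = ∑ m : Fin M, ∑ i ∈ S m, ω m i * (v m i - v' m i) ^ 2 / 2}

/-- The gap `Δ_i(v)`. -/
def Delta (S : Fin M → Finset (Fin K)) (v : Fin M → Fin K → ℝ) (i : Fin K) : ℝ :=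
  sInf {x | ∃ m : Fin M, i ∈ S m ∧
    x = |armMean S v i - sSup {y | ∃ j ∈ S m, j ≠ i ∧ y = armMean S v j}|}

/-- The denominator `(1/M_i²) ∑_{m : i ∈ S_m} 1/ω_{i,m}`. -/
def armDenom (S : Fin M → Finset (Fin K)) (ω : Fin M → Fin K → ℝ) (i : Fin K) : ℝ :=
  (1 / (Mi S i : ℝ) ^ 2) * ∑ m ∈ Finset.univ.filter (fun m => i ∈ S m), 1 / ω m i

/-- The simplified objective `g̃_v(ω)`. -/
def gtilde (S : Fin M → Finset (Fin K)) (v ω : Fin M → Fin K → ℝ) : ℝ :=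
  if ∃ m, ∃ i ∈ S m, ω m i = 0 then 0
  else sInf {x | ∃ i : Fin K, x = (Delta S v i) ^ 2 / 2 / armDenom S ω i}

/-- The relation `R` on arms: two arms are related if some client has access to both. -/
def armRel (S : Fin M → Finset (Fin K)) (i₁ i₂ : Fin K) : Prop :=
  ∃ m, i₁ ∈ S m ∧ i₂ ∈ S m

/-- The equivalence class `Q` of arm `i` under the smallest equivalence relation
containing `R`. -/
def armClass (S : Fin M → Finset (Fin K)) (i : Fin K) : Set (Fin K) :=
  {i' | Relation.EqvGen (armRel S) i i'}

/-- Same equivalence class, as a `Finset`. -/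
def classFinset (S : Fin M → Finset (Fin K)) (i : Fin K) : Finset (Fin K) :=
  Finset.univ.filter fun i' => Relation.EqvGen (armRel S) i i'

/-- The per-class objective `g̃_v^{(j)}(ω)` where `Q` is the `j`-th equivalence class. -/
def gtildeC (S : Fin M → Finset (Fin K)) (v : Fin M → Fin K → ℝ) (Q : Set (Fin K))
    (ω : Fin M → Fin K → ℝ) : ℝ :=
  if ∃ m, ∃ i ∈ S m, i ∈ Q ∧ ω m i = 0 then 0
  else sInf {x | ∃ i ∈ Q, x = (Delta S v i) ^ 2 / armDenom S ω i}

/-- `ω` is a common solution: it simultaneously attains `max_{ω'∈Γ} g̃_v(ω')` and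
`max_{ω'∈Γ} g̃_v^{(j)}(ω')` for every equivalence class `Q_j`. -/
def IsCommonSol (S : Fin M → Finset (Fin K)) (v ω : Fin M → Fin K → ℝ) : Prop :=
  ω ∈ Gam S ∧ (∀ ω' ∈ Gam S, gtilde S v ω' ≤ gtilde S v ω) ∧
    ∀ i : Fin K, ∀ ω' ∈ Gam S,
      gtildeC S v (armClass S i) ω' ≤ gtildeC S v (armClass S i) ω

/-- The balanced condition. -/
def BalancedCond (S : Fin M → Finset (Fin K)) (ω : Fin M → Fin K → ℝ) : Prop :=
  ∀ m₁ m₂ : Fin M, ∀ i₁ i₂ : Fin K, i₁ ∈ S m₁ → i₂ ∈ S m₁ → i₁ ∈ S m₂ → i₂ ∈ S m₂ →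
    ω m₁ i₁ / ω m₁ i₂ = ω m₂ i₁ / ω m₂ i₂

/-- The pseudo-balanced condition for instance `v`. -/
def PseudoBalancedCond (S : Fin M → Finset (Fin K)) (v ω : Fin M → Fin K → ℝ) : Prop :=
  ∀ i₁ i₂ : Fin K, Relation.EqvGen (armRel S) i₁ i₂ →
    (Delta S v i₁) ^ 2 / armDenom S ω i₁ = (Delta S v i₂) ^ 2 / armDenom S ω i₂

/-- The matrix `H(v)` (restricted to a class it gives `H^{(j)}(v)`). -/
def Hmat (S : Fin M → Finset (Fin K)) (v : Fin M → Fin K → ℝ) (i₁ i₂ : Fin K) : ℝ :=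
  (1 / ((Delta S v i₁) ^ 2 * (Mi S i₁ : ℝ) ^ 2)) *
    ((Finset.univ.filter fun m => i₁ ∈ S m ∧ i₂ ∈ S m).card : ℝ)

/-- Perron eigenvector for a symmetric nonnegative matrix with positive diagonal weights. -/
theorem perron_exists {ι : Type*} [Fintype ι] [Nonempty ι] (B : ι → ι → ℝ) (d : ι → ℝ)
    (hd : ∀ i, 0 < d i) (hB : ∀ i j, 0 ≤ B i j) (hsym : ∀ i j, B i j = B j i) :
    ∃ u : ι → ℝ, ∃ ρ : ℝ, u ≠ 0 ∧ (∀ i, 0 ≤ u i) ∧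
      ∀ i, ∑ j, B i j * u j = ρ * d i * u i := by
  let q : (ι → ℝ) → ℝ := fun x => ∑ i, ∑ j, B i j * (x i * x j)
  let N : (ι → ℝ) → ℝ := fun x => ∑ i, d i * x i ^ 2
  have hqc : Continuous q := by fun_prop
  have hNc : Continuous N := by fun_prop
  have hN0 : ∀ x, 0 ≤ N x := fun x =>
    Finset.sum_nonneg fun i _ => mul_nonneg (hd i).le (sq_nonneg _)
  have hNz : ∀ x, N x = 0 → x = 0 := by
    intro x hx
    have := (Finset.sum_eq_zero_iff_of_nonneg
      (fun i _ => mul_nonneg (hd i).le (sq_nonneg (x i)))).1 hx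
    funext i
    have h1 := this i (Finset.mem_univ i)
    rcases mul_eq_zero.1 h1 with h | h
    · exact absurd h (hd i).ne'
    · simpa using h
  have hqs : ∀ (c : ℝ) x, q (c • x) = c ^ 2 * q x := by
    intro c x
    simp only [q, Finset.mul_sum, Pi.smul_apply, smul_eq_mul]
    refine Finset.sum_congr rfl fun i _ => Finset.sum_congr rfl fun j _ => by ring
  have hNs : ∀ (c : ℝ) x, N (c • x) = c ^ 2 * N x := by
    intro c x
    simp only [N, Finset.mul_sum, Pi.smul_apply, smul_eq_mul]
    refine Finset.sum_congr rfl fun i _ => by ring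
  have hnorm : ∀ x, x ≠ 0 → N ((1 / Real.sqrt (N x)) • x) = 1 := by
    intro x hx
    have hp : 0 < N x := lt_of_le_of_ne (hN0 x) (fun h => hx (hNz x h.symm))
    rw [hNs, div_pow, Real.sq_sqrt hp.le]
    field_simp
  have hcomp : IsCompact {x | N x = 1} := by
    have hcl : IsClosed {x | N x = 1} := isClosed_eq hNc continuous_const
    have hsub : {x | N x = 1} ⊆
        Set.pi Set.univ (fun i => Set.Icc (-(1 + 1 / d i)) (1 + 1 / d i)) := by
      intro x hx i _
      have h1 : d i * x i ^ 2 ≤ 1 := by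
        have h2 : N x = 1 := hx
        rw [← h2]
        exact Finset.single_le_sum (f := fun i => d i * x i ^ 2)
          (fun i _ => mul_nonneg (hd i).le (sq_nonneg (x i))) (Finset.mem_univ i)
      have h3 : x i ^ 2 ≤ 1 / d i := by
        rw [le_div_iff₀ (hd i)]; linarith
      have h4 : 0 < 1 / d i := by have := hd i; positivity
      have h5 : |x i| ≤ |1 + 1 / d i| := by
        apply sq_le_sq.1
        nlinarith
      rw [abs_of_pos (by linarith : 0 < 1 + 1 / d i)] at h5
      exact abs_le.1 h5
    exact (isCompact_univ_pi fun i => isCompact_Icc).of_isClosed_subset hcl hsub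
  have hne : {x | N x = 1}.Nonempty := by
    obtain ⟨i⟩ := ‹Nonempty ι›
    refine ⟨_, hnorm (fun _ => 1) ?_⟩
    intro h
    have := congrFun h i
    simp at this
  obtain ⟨x₀, hx₀, hmax⟩ := hcomp.exists_isMaxOn hne hqc.continuousOn
  let u : ι → ℝ := fun i => |x₀ i|
  have hNu : N u = 1 := by
    have : N u = N x₀ := by simp [N, u, sq_abs]
    rw [this]; exact hx₀
  have hqu : q x₀ ≤ q u := by
    refine Finset.sum_le_sum fun i _ => Finset.sum_le_sum fun j _ => ?_
    refine mul_le_mul_of_nonneg_left ?_ (hB i j)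
    rw [← abs_mul]; exact le_abs_self _
  have hall : ∀ x, q x ≤ q u * N x := by
    intro x
    by_cases hx : x = 0
    · subst hx
      simp [q, N]
    · have hp : 0 < N x := lt_of_le_of_ne (hN0 x) (fun h => hx (hNz x h.symm))
      have h1 : q ((1 / Real.sqrt (N x)) • x) ≤ q x₀ := hmax (hnorm x hx)
      rw [hqs, div_pow, Real.sq_sqrt hp.le] at h1
      have h2 := h1.trans hqu
      rw [one_pow, one_div, inv_mul_le_iff₀ hp] at h2
      linarith
  refine ⟨u, q u, ?_, fun i => abs_nonneg _, ?_⟩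
  · intro h
    rw [h] at hNu
    simp [N] at hNu
  intro i
  have hexp : ∀ t : ℝ, 2 * t * (∑ j, B i j * u j - q u * d i * u i)
      + t ^ 2 * (B i i - q u * d i) ≤ 0 := by
    intro t
    have h := hall (u + t • Pi.single i 1)
    have e1 : q (u + t • Pi.single i 1) = q u + 2 * t * (∑ j, B i j * u j) + t ^ 2 * B i i := by
      have hx : ∀ k l, B k l * ((u + t • (Pi.single i 1 : ι → ℝ)) k * (u + t • (Pi.single i 1 : ι → ℝ)) l)
          = B k l * (u k * u l) + (if k = i then t * (B i l * u l) else 0)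
            + (if l = i then t * (B i k * u k) else 0)
            + (if k = i then if l = i then t ^ 2 * B i i else 0 else 0) := by
        intro k l
        simp only [Pi.add_apply, Pi.smul_apply, smul_eq_mul, Pi.single_apply]
        by_cases hk : k = i <;> by_cases hl : l = i
        · subst hk; subst hl; simp; ring
        · subst hk; simp [hl]; ring
        · subst hl; simp [hk, hsym k l]; ring
        · simp [hk, hl]
      simp only [q, hx, Finset.sum_add_distrib]
      have a1 : ∑ k, ∑ l, (if k = i then t * (B i l * u l) else 0) = t * ∑ j, B i j * u j := by
        rw [Finset.sum_comm]; simp [Finset.mul_sum]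
      have a2 : ∑ k, ∑ l, (if l = i then t * (B i k * u k) else 0) = t * ∑ j, B i j * u j := by
        simp [Finset.mul_sum]
      have a3 : ∑ k, ∑ l, (if k = i then if l = i then t ^ 2 * B i i else 0 else 0)
          = t ^ 2 * B i i := by
        rw [Finset.sum_comm]; simp
      rw [a1, a2, a3]; ring
    have e2 : N (u + t • Pi.single i 1) = N u + 2 * t * (d i * u i) + t ^ 2 * d i := by
      have hx : ∀ k, d k * ((u + t • (Pi.single i 1 : ι → ℝ)) k) ^ 2
          = d k * u k ^ 2 + (if k = i then 2 * t * (d i * u i) + t ^ 2 * d i else 0) := by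
        intro k
        simp only [Pi.add_apply, Pi.smul_apply, smul_eq_mul, Pi.single_apply]
        by_cases hk : k = i
        · subst hk; simp; ring
        · simp [hk]
      simp only [N, hx, Finset.sum_add_distrib]
      simp; ring
    rw [e1, e2, hNu] at h
    linarith
  set a := ∑ j, B i j * u j - q u * d i * u i with ha
  set b := B i i - q u * d i with hb
  have : a = 0 := by
    by_contra hne
    have hsq : 0 < a ^ 2 := by positivity
    have h1 := hexp (a / (1 + |b|))
    have hpos : 0 < 1 + |b| := by positivity
    have h2 : 2 * (a / (1 + |b|)) * a + (a / (1 + |b|)) ^ 2 * b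
        = a ^ 2 * (2 * (1 + |b|) + b) / (1 + |b|) ^ 2 := by
      field_simp
    rw [h2] at h1
    have h3 : 0 < 2 * (1 + |b|) + b := by
      have := neg_abs_le b
      have := abs_nonneg b
      linarith
    have : 0 < a ^ 2 * (2 * (1 + |b|) + b) / (1 + |b|) ^ 2 := by positivity
    linarith
  linarith

/-- Version of `perron_exists` on a finset. -/
theorem perron_exists_on {ι : Type*} (Q : Finset ι) (hQ : Q.Nonempty)
    (B : ι → ι → ℝ) (d : ι → ℝ)
    (hd : ∀ i ∈ Q, 0 < d i) (hB : ∀ i j, 0 ≤ B i j) (hsym : ∀ i j, B i j = B j i) :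
    ∃ u : ι → ℝ, ∃ ρ : ℝ, (∃ i ∈ Q, u i ≠ 0) ∧ (∀ i, 0 ≤ u i) ∧ (∀ i ∉ Q, u i = 0) ∧
      ∀ i ∈ Q, ∑ j ∈ Q, B i j * u j = ρ * d i * u i := by
  haveI : Nonempty Q := hQ.to_subtype
  obtain ⟨u, ρ, h0, hn, he⟩ := perron_exists (ι := Q) (fun i j => B i j) (fun i => d i)
    (fun i => hd i i.2) (fun i j => hB i j) (fun i j => hsym i j)
  let w : ι → ℝ := fun i => if h : i ∈ Q then u ⟨i, h⟩ else 0
  have hw : ∀ i : Q, w i = u i := fun i => by simp [w]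
  refine ⟨w, ρ, ?_, ?_, ?_, ?_⟩
  · obtain ⟨i, hi⟩ := Function.ne_iff.1 h0
    exact ⟨i, i.2, by rw [hw]; exact hi⟩
  · intro i
    by_cases h : i ∈ Q
    · simp [w, h, hn]
    · simp [w, h]
  · intro i hi
    simp [w, hi]
  · intro i hi
    rw [← Finset.sum_coe_sort Q]
    have := he ⟨i, hi⟩
    simp only [hw]
    rw [this, ← hw]

theorem Delta_pos (S : Fin M → Finset (Fin K))
    (hS : ∀ m, 2 ≤ (S m).card) (hcov : ∀ i : Fin K, ∃ m, i ∈ S m)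
    (v : Fin M → Fin K → ℝ) (hv : v ∈ PSet S) (i : Fin K) : 0 < Delta S v i := by
  have hfin : {x | ∃ m : Fin M, i ∈ S m ∧
    x = |armMean S v i - sSup {y | ∃ j ∈ S m, j ≠ i ∧ y = armMean S v j}|}.Finite := by
    refine (Set.finite_range (fun m : Fin M =>
      |armMean S v i - sSup {y | ∃ j ∈ S m, j ≠ i ∧ y = armMean S v j}|)).subset ?_
    rintro x ⟨m, _, rfl⟩
    exact ⟨m, rfl⟩
  have hne : {x | ∃ m : Fin M, i ∈ S m ∧
    x = |armMean S v i - sSup {y | ∃ j ∈ S m, j ≠ i ∧ y = armMean S v j}|}.Nonempty := by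
    obtain ⟨m, hm⟩ := hcov i
    exact ⟨_, m, hm, rfl⟩
  obtain ⟨m, hm, hx⟩ := hne.csInf_mem hfin
  unfold Delta
  rw [hx, abs_pos, sub_ne_zero]
  have hfin2 : {y | ∃ j ∈ S m, j ≠ i ∧ y = armMean S v j}.Finite := by
    refine (Set.finite_range (armMean S v)).subset ?_
    rintro x ⟨j, _, _, rfl⟩
    exact ⟨j, rfl⟩
  have hne2 : {y | ∃ j ∈ S m, j ≠ i ∧ y = armMean S v j}.Nonempty := by
    obtain ⟨j, hj, hji⟩ := Finset.exists_mem_ne (by have := hS m; omega : 1 < (S m).card) i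
    exact ⟨_, j, hj, hji, rfl⟩
  obtain ⟨b, hb, hbest⟩ := hv m
  obtain ⟨j, hj, hji, he⟩ := hne2.csSup_mem hfin2
  by_cases hib : i = b
  · subst hib
    rw [he]
    exact (hbest j hj hji).ne'
  · have h1 := hbest i hm hib
    have h2 : armMean S v b ≤ sSup {y | ∃ j ∈ S m, j ≠ i ∧ y = armMean S v j} :=
      le_csSup hfin2.bddAbove ⟨b, hb, fun h => hib h.symm, rfl⟩
    exact (h1.trans_le h2).ne

/-- Number of common clients. -/
def Bc (S : Fin M → Finset (Fin K)) (i j : Fin K) : ℝ :=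
  ((Finset.univ.filter fun m => i ∈ S m ∧ j ∈ S m).card : ℝ)

theorem Bc_eq (S : Fin M → Finset (Fin K)) (i j : Fin K) :
    Bc S i j = ∑ m : Fin M, if i ∈ S m ∧ j ∈ S m then 1 else 0 := by
  simp [Bc]

theorem Bc_row (S : Fin M → Finset (Fin K)) (Q : Finset (Fin K)) (i : Fin K) (u : Fin K → ℝ) :
    ∑ j ∈ Q, Bc S i j * u j =
      ∑ m ∈ Finset.univ.filter (fun m => i ∈ S m), ∑ j ∈ Q.filter (fun j => j ∈ S m), u j := by
  simp only [Bc_eq, Finset.sum_mul]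
  rw [Finset.sum_comm, Finset.sum_filter]
  refine Finset.sum_congr rfl fun m _ => ?_
  by_cases h : i ∈ S m
  · simp [h, Finset.sum_filter]
  · simp [h]

theorem armRel_mem {S : Fin M → Finset (Fin K)} {i₀ i j : Fin K} {m : Fin M}
    (hi : i ∈ classFinset S i₀) (him : i ∈ S m) (hjm : j ∈ S m) : j ∈ classFinset S i₀ := by
  simp only [classFinset, Finset.mem_filter, Finset.mem_univ, true_and] at hi ⊢
  exact hi.trans _ _ _ (Relation.EqvGen.rel _ _ ⟨m, him, hjm⟩)

/-- A nonnegative eigenvector with a zero in the class vanishes on the class. -/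
theorem propagate (S : Fin M → Finset (Fin K)) (i₀ : Fin K) (d : Fin K → ℝ) (ρ : ℝ)
    (y : Fin K → ℝ) (hy : ∀ i, 0 ≤ y i)
    (he : ∀ i ∈ classFinset S i₀, ∑ j ∈ classFinset S i₀, Bc S i j * y j = ρ * d i * y i)
    (i₁ : Fin K) (hi₁ : i₁ ∈ classFinset S i₀) (hz : y i₁ = 0) :
    ∀ i ∈ classFinset S i₀, y i = 0 := by
  have step : ∀ i j, armRel S i j → i ∈ classFinset S i₀ → y i = 0 → y j = 0 := by
    rintro i j ⟨m, him, hjm⟩ hi hzi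
    have hj := armRel_mem hi him hjm
    have h := he i hi
    rw [hzi, mul_zero] at h
    have hBn : ∀ k ∈ classFinset S i₀, 0 ≤ Bc S i k * y k := fun k _ =>
      mul_nonneg (by unfold Bc; positivity) (hy k)
    have h2 := (Finset.sum_eq_zero_iff_of_nonneg hBn).1 h j hj
    rcases mul_eq_zero.1 h2 with h3 | h3
    · exfalso
      unfold Bc at h3
      rw [Nat.cast_eq_zero, Finset.card_eq_zero] at h3
      have : m ∈ Finset.univ.filter fun m => i ∈ S m ∧ j ∈ S m := by simp [him, hjm]
      rw [h3] at this
      simp at this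
    · exact h3
  have key : ∀ i j, Relation.EqvGen (armRel S) i j →
      ((i ∈ classFinset S i₀ ∧ y i = 0) ↔ (j ∈ classFinset S i₀ ∧ y j = 0)) := by
    intro i j h
    induction h with
    | rel a b hab =>
      have hba : armRel S b a := by
        obtain ⟨m, h1, h2⟩ := hab
        exact ⟨m, h2, h1⟩
      refine ⟨fun h => ⟨?_, step a b hab h.1 h.2⟩, fun h => ⟨?_, step b a hba h.1 h.2⟩⟩
      · obtain ⟨m, h1, h2⟩ := hab
        exact armRel_mem h.1 h1 h2
      · obtain ⟨m, h1, h2⟩ := hab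
        exact armRel_mem h.1 h2 h1
    | refl a => exact Iff.rfl
    | symm a b _ ih => exact ih.symm
    | trans a b c _ _ ih1 ih2 => exact ih1.trans ih2
  intro i hi
  have hi' := hi
  have hi₁' := hi₁
  simp only [classFinset, Finset.mem_filter, Finset.mem_univ, true_and] at hi' hi₁'
  exact ((key i₁ i ((hi₁'.symm _ _).trans _ _ _ hi')).1 ⟨hi₁, hz⟩).2

/-- The optimal value of the class objective is the inverse of the Perron eigenvalue. -/
theorem value_eq (S : Fin M → Finset (Fin K)) (hS : ∀ m, 2 ≤ (S m).card)
    (hMi : ∀ i : Fin K, 0 < (Mi S i : ℝ)) (v : Fin M → Fin K → ℝ)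
    (hD : ∀ i, 0 < Delta S v i)
    (ωt : Fin M → Fin K → ℝ) (hωt : IsCommonSol S v ωt) (i₀ : Fin K)
    (u : Fin K → ℝ) (ρ : ℝ) (hρ : 0 < ρ)
    (hu : ∀ i ∈ classFinset S i₀, 0 < u i)
    (he : ∀ i ∈ classFinset S i₀, ∑ j ∈ classFinset S i₀, Bc S i j * u j =
      ρ * (Delta S v i ^ 2 * (Mi S i : ℝ) ^ 2) * u i) :
    1 / gtildeC S v (armClass S i₀) ωt = ρ := by
  set Q := classFinset S i₀ with hQ
  have hmem : ∀ i, i ∈ armClass S i₀ ↔ i ∈ Q := by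
    intro i; simp [hQ, armClass, classFinset]
  have hi₀ : i₀ ∈ Q := by
    rw [← hmem]; exact Relation.EqvGen.refl _
  -- lower bound
  let w : Fin K → ℝ := fun i => if i ∈ Q then u i else 1
  have hw : ∀ i, 0 < w i := by
    intro i
    by_cases h : i ∈ Q
    · simp [w, h, hu]
    · simp [w, h]
  have hsum : ∀ m, 0 < ∑ i ∈ S m, w i := by
    intro m
    refine Finset.sum_pos (fun i _ => hw i) ?_
    rw [← Finset.card_pos]; have := hS m; omega
  let ω : Fin M → Fin K → ℝ := fun m i => if i ∈ S m then w i / ∑ j ∈ S m, w j else 0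
  have hωpos : ∀ m, ∀ i ∈ S m, 0 < ω m i := by
    intro m i hi
    simp only [ω, hi, if_true]
    exact div_pos (hw i) (hsum m)
  have hωG : ω ∈ Gam S := by
    refine ⟨fun m i hi => (hωpos m i hi).le, fun m => ?_, fun m i hi => by simp [ω, hi]⟩
    have : ∑ i ∈ S m, ω m i = ∑ i ∈ S m, w i / ∑ j ∈ S m, w j :=
      Finset.sum_congr rfl fun i hi => by simp [ω, hi]
    rw [this, ← Finset.sum_div, div_self (hsum m).ne']
  have hden : ∀ i ∈ Q, armDenom S ω i = ρ * Delta S v i ^ 2 := by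
    intro i hi
    have h1 : ∑ m ∈ Finset.univ.filter (fun m => i ∈ S m), 1 / ω m i
        = (∑ j ∈ Q, Bc S i j * u j) / u i := by
      rw [Bc_row, Finset.sum_div]
      refine Finset.sum_congr rfl fun m hm => ?_
      have him : i ∈ S m := (Finset.mem_filter.1 hm).2
      have hfil : Q.filter (fun j => j ∈ S m) = S m := by
        ext j
        simp only [Finset.mem_filter]
        exact ⟨fun h => h.2, fun h => ⟨armRel_mem hi him h, h⟩⟩
      have hs : ∑ j ∈ S m, w j = ∑ j ∈ S m, u j :=
        Finset.sum_congr rfl fun j hj => by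
          have : j ∈ Q := armRel_mem hi him hj
          simp [w, this]
      rw [hfil, ← hs]
      simp [ω, him, w, hi]
    unfold armDenom
    rw [h1, he i hi]
    have := (hMi i).ne'
    have := (hu i hi).ne'
    field_simp
  have hval : gtildeC S v (armClass S i₀) ω = 1 / ρ := by
    unfold gtildeC
    rw [if_neg]
    · have : {x | ∃ i ∈ armClass S i₀, x = (Delta S v i) ^ 2 / armDenom S ω i} = {1 / ρ} := by
        ext x
        simp only [Set.mem_ofPred_eq, Set.mem_singleton_iff]
        have hh : ∀ i ∈ Q, (Delta S v i) ^ 2 / armDenom S ω i = 1 / ρ := by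
          intro i hi
          rw [hden i hi]
          have := (hD i).ne'
          field_simp
        constructor
        · rintro ⟨i, hi, rfl⟩
          exact hh i ((hmem i).1 hi)
        · rintro rfl
          exact ⟨i₀, (hmem _).2 hi₀, (hh i₀ hi₀).symm⟩
      rw [this, csInf_singleton]
    · rintro ⟨m, i, hi, _, h0⟩
      exact (hωpos m i hi).ne' h0
  have hge : 1 / ρ ≤ gtildeC S v (armClass S i₀) ωt := by
    rw [← hval]; exact hωt.2.2 i₀ ω hωG
  -- upper bound
  set γ := gtildeC S v (armClass S i₀) ωt with hγ
  have hγpos : 0 < γ := lt_of_lt_of_le (by positivity) hge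
  have hcond : ¬ ∃ m, ∃ i ∈ S m, i ∈ armClass S i₀ ∧ ωt m i = 0 := by
    intro h
    have : γ = 0 := by rw [hγ]; unfold gtildeC; rw [if_pos h]
    exact hγpos.ne' this
  have hωtpos : ∀ m, ∀ i ∈ S m, i ∈ Q → 0 < ωt m i := by
    intro m i hi hiQ
    refine lt_of_le_of_ne (hωt.1.1 m i hi) fun h => hcond ⟨m, i, hi, (hmem i).2 hiQ, h.symm⟩
  have hγle : ∀ i ∈ Q, γ * ∑ m ∈ Finset.univ.filter (fun m => i ∈ S m), 1 / ωt m i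
      ≤ Delta S v i ^ 2 * (Mi S i : ℝ) ^ 2 := by
    intro i hi
    have h1 : γ ≤ (Delta S v i) ^ 2 / armDenom S ωt i := by
      rw [hγ]; unfold gtildeC; rw [if_neg hcond]
      refine csInf_le ?_ ⟨i, (hmem i).2 hi, rfl⟩
      refine Set.Finite.bddBelow ((Set.finite_range
        (fun i => (Delta S v i) ^ 2 / armDenom S ωt i)).subset ?_)
      rintro x ⟨j, _, rfl⟩
      exact ⟨j, rfl⟩
    have hne : (Finset.univ.filter (fun m => i ∈ S m)).Nonempty := by
      rw [← Finset.card_pos]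
      have := hMi i
      unfold Mi at this
      exact_mod_cast this
    have hs : 0 < ∑ m ∈ Finset.univ.filter (fun m => i ∈ S m), 1 / ωt m i :=
      Finset.sum_pos (fun m hm => one_div_pos.2
        (hωtpos m i (Finset.mem_filter.1 hm).2 hi)) hne
    have hM := hMi i
    have hd : 0 < armDenom S ωt i := by unfold armDenom; positivity
    rw [le_div_iff₀ hd] at h1
    unfold armDenom at h1
    have h2 := mul_le_mul_of_nonneg_right h1 (by positivity : 0 ≤ (Mi S i : ℝ) ^ 2)
    refine le_trans (le_of_eq ?_) h2
    field_simp
  have hW : 0 < ∑ i ∈ Q, u i ^ 2 * (Delta S v i ^ 2 * (Mi S i : ℝ) ^ 2) := by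
    refine Finset.sum_pos (fun i hi => ?_) ⟨i₀, hi₀⟩
    have := hu i hi
    have := hMi i
    have := hD i
    positivity
  have hswap : ∀ f : Fin M → Fin K → ℝ,
      ∑ i ∈ Q, ∑ m ∈ Finset.univ.filter (fun m => i ∈ S m), f m i
        = ∑ m, ∑ i ∈ Q.filter (fun i => i ∈ S m), f m i := by
    intro f
    simp only [Finset.sum_filter]
    rw [Finset.sum_comm]
  have hA : ∑ m, (∑ i ∈ Q.filter (fun i => i ∈ S m), u i) ^ 2
      = ρ * ∑ i ∈ Q, u i ^ 2 * (Delta S v i ^ 2 * (Mi S i : ℝ) ^ 2) := by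
    have h1 : ∑ i ∈ Q, u i * ∑ j ∈ Q, Bc S i j * u j
        = ρ * ∑ i ∈ Q, u i ^ 2 * (Delta S v i ^ 2 * (Mi S i : ℝ) ^ 2) := by
      rw [Finset.mul_sum]
      refine Finset.sum_congr rfl fun i hi => ?_
      rw [he i hi]; ring
    rw [← h1]
    simp only [Bc_row, Finset.mul_sum]
    have h2 := hswap (fun m i => ∑ j ∈ Q.filter (fun j => j ∈ S m), u i * u j)
    rw [h2]
    refine Finset.sum_congr rfl fun m _ => ?_
    rw [sq, Finset.sum_mul_sum]
  have hBd : ∑ m, (∑ i ∈ Q.filter (fun i => i ∈ S m), u i) ^ 2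
      ≤ ∑ i ∈ Q, u i ^ 2 * ∑ m ∈ Finset.univ.filter (fun m => i ∈ S m), 1 / ωt m i := by
    simp only [Finset.mul_sum]
    have h2 := hswap (fun m i => u i ^ 2 * (1 / ωt m i))
    rw [h2]
    refine Finset.sum_le_sum fun m _ => ?_
    have hpos : ∀ i ∈ Q.filter (fun i => i ∈ S m), 0 < ωt m i := fun i hi =>
      hωtpos m i (Finset.mem_filter.1 hi).2 (Finset.mem_filter.1 hi).1
    have hterm : ∀ i ∈ Q.filter (fun i => i ∈ S m), 0 ≤ u i ^ 2 * (1 / ωt m i) := fun i hi => by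
      have := hpos i hi
      positivity
    have hcs := Finset.sum_sq_le_sum_mul_sum_of_sq_eq_mul (Q.filter (fun i => i ∈ S m))
      (r := u) (f := fun i => ωt m i) (g := fun i => u i ^ 2 * (1 / ωt m i))
      (fun i hi => (hpos i hi).le) hterm
      (fun i hi => by have := (hpos i hi).ne'; field_simp)
    have hle1 : ∑ i ∈ Q.filter (fun i => i ∈ S m), ωt m i ≤ 1 := by
      rw [← hωt.1.2.1 m]
      refine Finset.sum_le_sum_of_subset_of_nonneg
        (fun i hi => (Finset.mem_filter.1 hi).2) (fun i hi _ => hωt.1.1 m i hi)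
    refine hcs.trans ?_
    have := Finset.sum_nonneg hterm
    exact mul_le_of_le_one_left this hle1
  have hC : γ * ∑ i ∈ Q, u i ^ 2 * ∑ m ∈ Finset.univ.filter (fun m => i ∈ S m), 1 / ωt m i
      ≤ ∑ i ∈ Q, u i ^ 2 * (Delta S v i ^ 2 * (Mi S i : ℝ) ^ 2) := by
    rw [Finset.mul_sum]
    refine Finset.sum_le_sum fun i hi => ?_
    have := mul_le_mul_of_nonneg_left (hγle i hi) (sq_nonneg (u i))
    linarith
  have hle : γ ≤ 1 / ρ := by
    rw [le_div_iff₀ hρ]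
    rw [hA] at hBd
    have h3 := (mul_le_mul_of_nonneg_left hBd hγpos.le).trans hC
    rw [← mul_assoc] at h3
    exact le_of_mul_le_mul_right (by linarith) hW
  rw [le_antisymm hle hge, one_div_one_div]

/-- Lemma 15: for every class `Q_j`, the eigenspace of `H^(j)(v)` associated with the
eigenvalue `1/g̃_v^(j)(ω̃(v))` is one-dimensional. -/
theorem stmt11 (K M : ℕ) (hK : 2 ≤ K) (hM : 1 ≤ M) (S : Fin M → Finset (Fin K))
    (hS : ∀ m, 2 ≤ (S m).card) (hcov : ∀ i : Fin K, ∃ m, i ∈ S m)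
    (v : Fin M → Fin K → ℝ) (hv : v ∈ PSet S)
    (ωt : Fin M → Fin K → ℝ) (hωt : IsCommonSol S v ωt) :
    ∀ i₀ : Fin K,
      ∃ u : Fin K → ℝ, u ≠ 0 ∧ (∀ i ∉ classFinset S i₀, u i = 0) ∧
        (∀ i ∈ classFinset S i₀,
          ∑ i' ∈ classFinset S i₀, Hmat S v i i' * u i' =
            (1 / gtildeC S v (armClass S i₀) ωt) * u i) ∧
        ∀ x : Fin K → ℝ, (∀ i ∉ classFinset S i₀, x i = 0) →
          (∀ i ∈ classFinset S i₀,
            ∑ i' ∈ classFinset S i₀, Hmat S v i i' * x i' =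
              (1 / gtildeC S v (armClass S i₀) ωt) * x i) →
          ∃ c : ℝ, x = c • u := by
  intro i₀
  have hD := Delta_pos S hS hcov v hv
  have hMi : ∀ i : Fin K, 0 < (Mi S i : ℝ) := by
    intro i
    obtain ⟨m, hm⟩ := hcov i
    have : 0 < Mi S i := Finset.card_pos.2 ⟨m, by simp [hm]⟩
    exact_mod_cast this
  have hi₀ : i₀ ∈ classFinset S i₀ := by
    simp only [classFinset, Finset.mem_filter, Finset.mem_univ, true_and]
    exact Relation.EqvGen.refl _
  have hd : ∀ i, 0 < Delta S v i ^ 2 * (Mi S i : ℝ) ^ 2 := by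
    intro i
    have := hD i
    have := hMi i
    positivity
  obtain ⟨u, ρ, ⟨i₁, hi₁, hne⟩, hn, hoff, he⟩ := perron_exists_on (classFinset S i₀) ⟨i₀, hi₀⟩
    (Bc S) (fun i => Delta S v i ^ 2 * (Mi S i : ℝ) ^ 2) (fun i _ => hd i)
    (fun i j => by unfold Bc; positivity) (fun i j => by unfold Bc; simp only [and_comm])
  have hu : ∀ i ∈ classFinset S i₀, 0 < u i := by
    intro i hi
    refine lt_of_le_of_ne (hn i) fun h => hne ?_
    exact propagate S i₀ _ ρ u hn he i hi h.symm i₁ hi₁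
  have hρ : 0 < ρ := by
    have h1 := he i₀ hi₀
    have h2 : 0 < ∑ j ∈ classFinset S i₀, Bc S i₀ j * u j := by
      refine Finset.sum_pos' (fun j _ => mul_nonneg (by unfold Bc; positivity) (hn j))
        ⟨i₀, hi₀, mul_pos ?_ (hu i₀ hi₀)⟩
      have := hMi i₀
      unfold Bc
      unfold Mi at this
      simpa only [and_self] using this
    rw [h1] at h2
    have h3 := mul_pos (hd i₀) (hu i₀ hi₀)
    rw [mul_assoc] at h2
    exact pos_of_mul_pos_left h2 h3.le
  have hval := value_eq S hS hMi v hD ωt hωt i₀ u ρ hρ hu he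
  rw [hval]
  have hconv : ∀ (x : Fin K → ℝ) (i : Fin K),
      ∑ i' ∈ classFinset S i₀, Hmat S v i i' * x i'
        = (1 / (Delta S v i ^ 2 * (Mi S i : ℝ) ^ 2)) *
          ∑ i' ∈ classFinset S i₀, Bc S i i' * x i' := by
    intro x i
    rw [Finset.mul_sum]
    refine Finset.sum_congr rfl fun j _ => ?_
    unfold Hmat Bc
    ring
  refine ⟨u, fun h => hne (by rw [h]; rfl), hoff, ?_, ?_⟩
  · intro i hi
    rw [hconv, he i hi, one_div, inv_mul_eq_iff_eq_mul₀ (hd i).ne']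
    ring
  · intro x hx0 hx
    have hxe : ∀ i ∈ classFinset S i₀, ∑ j ∈ classFinset S i₀, Bc S i j * x j
        = ρ * (Delta S v i ^ 2 * (Mi S i : ℝ) ^ 2) * x i := by
      intro i hi
      have h := hx i hi
      rw [hconv, one_div, inv_mul_eq_iff_eq_mul₀ (hd i).ne'] at h
      rw [h]; ring
    obtain ⟨k, hk, hmin⟩ := Finset.exists_min_image (classFinset S i₀) (fun i => x i / u i)
      ⟨i₀, hi₀⟩
    refine ⟨x k / u k, ?_⟩
    have hy : ∀ i, 0 ≤ x i - x k / u k * u i := by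
      intro i
      by_cases hi : i ∈ classFinset S i₀
      · have := hmin i hi
        rw [le_div_iff₀ (hu i hi)] at this
        linarith
      · simp [hx0 i hi, hoff i hi]
    have hz := propagate S i₀ (fun i => Delta S v i ^ 2 * (Mi S i : ℝ) ^ 2) ρ
      (fun i => x i - x k / u k * u i) hy (by
        intro i hi
        have : ∑ j ∈ classFinset S i₀, Bc S i j * (x j - x k / u k * u j)
            = ∑ j ∈ classFinset S i₀, Bc S i j * x j
              - x k / u k * ∑ j ∈ classFinset S i₀, Bc S i j * u j := by
          rw [Finset.mul_sum, ← Finset.sum_sub_distrib]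
          exact Finset.sum_congr rfl fun j _ => by ring
        rw [this, hxe i hi, he i hi]
        ring) k hk (by have := (hu k hk).ne'; field_simp; simp)
    funext i
    simp only [Pi.smul_apply, smul_eq_mul]
    by_cases hi : i ∈ classFinset S i₀
    · have := hz i hi
      linarith
    · simp [hx0 i hi, hoff i hi]

end

end HetTS
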